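/- Let (S, *, ∘) be an ALD-system and γ ∈ S. Suppose that there is no equality u[⃗s](γ) = v[⃗t](γ) in S, where u, v ∈ T₁^∘, ⃗s and ⃗t are finite sequences of terms of T₁^* whose lengths equal the sizes of u and v respectively, and either u < v holds, or u = v and ⃗s ⃗⊏ ⃗t hold. Then for all terms t, t' ∈ T₁^{*,∘} with t(γ) = t'(γ), one has t =_ALD t'; i.e., the sub-ALD-system of S generated by γ is free based on {γ}. -/

import Mathlib

/-- Terms in a single variable over the single operation symbol `∘`. -/
inductive CTerm : Type
  | var : CTerm
  | circ : CTerm → CTerm → CTerm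

/-- Terms in a single variable over the single operation symbol `*`. -/
inductive STerm1 : Type
  | var : STerm1
  | star : STerm1 → STerm1 → STerm1

/-- Terms in a single variable over the two operation symbols `*` and `∘`. -/
inductive Term1 : Type
  | var : Term1
  | star : Term1 → Term1 → Term1
  | circ : Term1 → Term1 → Term1

/-- The canonical embedding of `*`-terms into `{*,∘}`-terms. -/
def STerm1.toTerm1 : STerm1 → Term1
  | .var => .var
  | .star u v => .star u.toTerm1 v.toTerm1

/-- The smallest congruence on one-variable `{*,∘}`-terms containing all instances of
(LD), (ALD₁), (ALD₂). -/
inductive ALDCong : Term1 → Term1 → Prop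
  | LD (t₁ t₂ t₃ : Term1) :
      ALDCong (.star t₁ (.star t₂ t₃)) (.star (.star t₁ t₂) (.star t₁ t₃))
  | ALD1 (t₁ t₂ t₃ : Term1) :
      ALDCong (.star (.circ t₁ t₂) t₃) (.star t₁ (.star t₂ t₃))
  | ALD2 (t₁ t₂ t₃ : Term1) :
      ALDCong (.star t₁ (.circ t₂ t₃)) (.circ (.star t₁ t₂) (.star t₁ t₃))
  | refl (t : Term1) : ALDCong t t
  | symm {s t : Term1} : ALDCong s t → ALDCong t s
  | trans {s t u : Term1} : ALDCong s t → ALDCong t u → ALDCong s u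
  | starCong {s s' t t' : Term1} : ALDCong s s' → ALDCong t t' →
      ALDCong (.star s t) (.star s' t')
  | circCong {s s' t t' : Term1} : ALDCong s s' → ALDCong t t' →
      ALDCong (.circ s t) (.circ s' t')

/-- `Subst v ⃗t t` means `t = v[⃗t]`: `t` is obtained from `v` by substituting the
entries of `⃗t` for the successive variable occurrences of `v` from left to right. -/
inductive Subst : CTerm → List STerm1 → Term1 → Prop
  | var (s : STerm1) : Subst .var [s] s.toTerm1
  | circ {u v : CTerm} {ss ts : List STerm1} {t₁ t₂ : Term1} :
      Subst u ss t₁ → Subst v ts t₂ → Subst (.circ u v) (ss ++ ts) (.circ t₁ t₂)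

/-- The linear order `u < v` on `∘`-terms: `x < v` for `v ≠ x`; and
`u₁∘u₂ < v₁∘v₂` iff `u₁ < v₁`, or `u₁ = v₁` and `u₂ < v₂`. -/
inductive CTerm.lt : CTerm → CTerm → Prop
  | var (v₁ v₂ : CTerm) : CTerm.lt .var (.circ v₁ v₂)
  | left {u₁ v₁ : CTerm} (u₂ v₂ : CTerm) : CTerm.lt u₁ v₁ →
      CTerm.lt (.circ u₁ u₂) (.circ v₁ v₂)
  | right (u₁ : CTerm) {u₂ v₂ : CTerm} : CTerm.lt u₂ v₂ →
      CTerm.lt (.circ u₁ u₂) (.circ u₁ v₂)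

/-- `s ⊏ t` holds iff `t = (⋯((s*t₁)*t₂)⋯)*t_p` for some `p ≥ 1` and terms
`t₁, …, t_p`. -/
inductive Sqsub : STerm1 → STerm1 → Prop
  | base (s t₁ : STerm1) : Sqsub s (.star s t₁)
  | step {s t : STerm1} (t' : STerm1) : Sqsub s t → Sqsub s (.star t t')

/-- `⃗s ⃗⊏ ⃗t` holds iff the sequences have equal lengths and there is `k` with
`s_i = t_i` for `i < k` and `s_k ⊏ t_k`. -/
inductive VSqsub : List STerm1 → List STerm1 → Prop
  | head {s t : STerm1} {l₁ l₂ : List STerm1} :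
      Sqsub s t → l₁.length = l₂.length → VSqsub (s :: l₁) (t :: l₂)
  | cons (s : STerm1) {l₁ l₂ : List STerm1} : VSqsub l₁ l₂ →
      VSqsub (s :: l₁) (s :: l₂)

/-- The evaluation `t(γ)` of a one-variable `{*,∘}`-term at `γ` in `(S, *, ∘)`. -/
def evalT {S : Type*} (star circ : S → S → S) (γ : S) : Term1 → S
  | .var => γ
  | .star u v => star (evalT star circ γ u) (evalT star circ γ v)
  | .circ u v => circ (evalT star circ γ u) (evalT star circ γ v)

/-! ### Expansions of `*`-terms under left self-distributivity -/

/-- One application of the left self-distributivity law, from left to right, to a subterm. -/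
inductive LDStep : STerm1 → STerm1 → Prop
  | dist (a b c : STerm1) :
      LDStep (.star a (.star b c)) (.star (.star a b) (.star a c))
  | left {a a' : STerm1} (b : STerm1) : LDStep a a' → LDStep (.star a b) (.star a' b)
  | right (a : STerm1) {b b' : STerm1} : LDStep b b' → LDStep (.star a b) (.star a b')

/-- `LDExp s t` means that `t` is obtained from `s` by finitely many LD-expansion steps. -/
abbrev LDExp : STerm1 → STerm1 → Prop := Relation.ReflTransGen LDStep

/-- Two terms are LD-equivalent when they have a common LD-expansion. -/
abbrev LDEquiv : STerm1 → STerm1 → Prop := Relation.Join LDExp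

theorem LDExp.star {a a' b b' : STerm1} (ha : LDExp a a') (hb : LDExp b b') :
    LDExp (.star a b) (.star a' b') :=
  (ha.lift (fun t => STerm1.star t b) fun _ _ h => .left b h).trans
    (hb.lift (fun t => STerm1.star a' t) fun _ _ h => .right a' h)

namespace STerm1

/-- The term obtained from the second argument by replacing each variable `x` by `t * x`. -/
def distribute (t : STerm1) : STerm1 → STerm1
  | .var => .star t .var
  | .star a b => .star (distribute t a) (distribute t b)

/-- The full expansion `∂t` of a term `t`, a common expansion of all one-step expansions. -/
def fullExp : STerm1 → STerm1
  | .var => .var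
  | .star a b => distribute (fullExp a) (fullExp b)

/-- The right powers `x, x * x, x * (x * x), …` of the variable. -/
def rightPow : ℕ → STerm1
  | 0 => .var
  | n + 1 => .star .var (rightPow n)

theorem ldExp_distribute (t s : STerm1) : LDExp (.star t s) (distribute t s) := by
  induction s with
  | var => exact .refl
  | star a b iha ihb => exact (Relation.ReflTransGen.single (.dist t a b)).trans (iha.star ihb)

theorem ldExp_fullExp (t : STerm1) : LDExp t (fullExp t) := by
  induction t with
  | var => exact .refl
  | star a b iha ihb => exact (iha.star ihb).trans (ldExp_distribute _ _)

theorem distribute_mono_left {t t' : STerm1} (h : LDExp t t') (s : STerm1) :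
    LDExp (distribute t s) (distribute t' s) := by
  induction s with
  | var => exact h.star .refl
  | star a b iha ihb => exact iha.star ihb

theorem distribute_step_right (t : STerm1) {s s' : STerm1} (h : LDStep s s') :
    LDStep (distribute t s) (distribute t s') := by
  induction h with
  | dist a b c => exact .dist _ _ _
  | left b _ ih => exact .left _ ih
  | right a _ ih => exact .right _ ih

theorem distribute_mono_right (t : STerm1) {s s' : STerm1} (h : LDExp s s') :
    LDExp (distribute t s) (distribute t s') :=
  h.lift (distribute t) fun _ _ => distribute_step_right t

theorem ldExp_distribute_distribute (a b c : STerm1) :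
    LDExp (distribute a (distribute b c)) (distribute (distribute a b) (distribute a c)) := by
  induction c with
  | var => exact ldExp_distribute (distribute a b) (.star a .var)
  | star c d ihc ihd => exact ihc.star ihd

theorem ldExp_star_distribute (a b c : STerm1) :
    LDExp (.star (distribute a b) (distribute a c)) (distribute a (distribute b c)) := by
  induction c with
  | var => exact .refl
  | star c d ihc ihd =>
    exact (Relation.ReflTransGen.single (.dist _ _ _)).trans (ihc.star ihd)

theorem ldExp_fullExp_of_step {s t : STerm1} (h : LDStep s t) : LDExp t (fullExp s) := by
  induction h with
  | dist a b c =>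
    have ha := ldExp_fullExp a
    have hab := (ha.star (ldExp_fullExp b)).trans (ldExp_distribute _ _)
    have hac := (ha.star (ldExp_fullExp c)).trans (ldExp_distribute _ _)
    exact (LDExp.star hab hac).trans (ldExp_star_distribute _ _ _)
  | left b _ ih => exact (ih.star (ldExp_fullExp b)).trans (ldExp_distribute _ _)
  | right a _ ih => exact ((ldExp_fullExp a).star ih).trans (ldExp_distribute _ _)

theorem fullExp_mono_step {s t : STerm1} (h : LDStep s t) : LDExp (fullExp s) (fullExp t) := by
  induction h with
  | dist a b c => exact ldExp_distribute_distribute _ _ _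
  | left b _ ih => exact distribute_mono_left ih _
  | right a _ ih => exact distribute_mono_right _ ih

theorem fullExp_mono {s t : STerm1} (h : LDExp s t) : LDExp (fullExp s) (fullExp t) := by
  induction h with
  | refl => exact .refl
  | tail _ h ih => exact ih.trans (fullExp_mono_step h)

theorem iterate_fullExp_mono (n : ℕ) {s t : STerm1} (h : LDExp s t) :
    LDExp (fullExp^[n] s) (fullExp^[n] t) := by
  induction n generalizing s t with
  | zero => exact h
  | succ n ih => exact ih (fullExp_mono h)

theorem iterate_fullExp_le {m n : ℕ} (h : m ≤ n) (s : STerm1) :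
    LDExp (fullExp^[m] s) (fullExp^[n] s) := by
  induction h with
  | refl => exact .refl
  | step _ ih =>
    rw [Function.iterate_succ_apply']
    exact ih.trans (ldExp_fullExp _)

theorem exists_ldExp_iterate_fullExp {s t : STerm1} (h : LDExp s t) :
    ∃ n : ℕ, LDExp t (fullExp^[n] s) := by
  induction h using Relation.ReflTransGen.head_induction_on with
  | refl => exact ⟨0, .refl⟩
  | head h _ ih =>
    obtain ⟨n, hn⟩ := ih
    exact ⟨n + 1, hn.trans (iterate_fullExp_mono n (ldExp_fullExp_of_step h))⟩

end STerm1

open STerm1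

theorem LDExp.confluent {s t u : STerm1} (ht : LDExp s t) (hu : LDExp s u) : LDEquiv t u := by
  obtain ⟨m, hm⟩ := exists_ldExp_iterate_fullExp ht
  obtain ⟨n, hn⟩ := exists_ldExp_iterate_fullExp hu
  exact ⟨fullExp^[max m n] s, hm.trans (iterate_fullExp_le (le_max_left m n) s),
    hn.trans (iterate_fullExp_le (le_max_right m n) s)⟩

theorem LDExp.ldEquiv {s t : STerm1} (h : LDExp s t) : LDEquiv s t := ⟨t, h, .refl⟩

theorem LDEquiv.symm {s t : STerm1} (h : LDEquiv s t) : LDEquiv t s :=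
  h.imp fun _ h => h.symm

theorem LDEquiv.trans {s t u : STerm1} (h : LDEquiv s t) (h' : LDEquiv t u) : LDEquiv s u := by
  obtain ⟨v, hsv, htv⟩ := h
  obtain ⟨w, htw, huw⟩ := h'
  obtain ⟨r, hvr, hwr⟩ := htv.confluent htw
  exact ⟨r, hsv.trans hvr, huw.trans hwr⟩

theorem LDEquiv.star {a a' b b' : STerm1} (ha : LDEquiv a a') (hb : LDEquiv b b') :
    LDEquiv (.star a b) (.star a' b') := by
  obtain ⟨c, h₁, h₂⟩ := ha
  obtain ⟨d, h₃, h₄⟩ := hb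
  exact ⟨.star c d, h₁.star h₃, h₂.star h₄⟩

/-- Absorption: every term acts on sufficiently large right powers as the variable does. -/
theorem exists_star_rightPow_ldEquiv (t : STerm1) :
    ∃ N : ℕ, ∀ n ≥ N, LDEquiv (.star t (rightPow n)) (rightPow (n + 1)) := by
  induction t with
  | var => exact ⟨0, fun n _ => LDExp.ldEquiv .refl⟩
  | star a b iha ihb =>
    obtain ⟨M, hM⟩ := iha
    obtain ⟨N, hN⟩ := ihb
    refine ⟨max M N + 1, fun n hn => ?_⟩
    obtain ⟨k, rfl⟩ : ∃ k, n = k + 1 := ⟨n - 1, by omega⟩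
    have ha : LDEquiv (.star (.star a b) (rightPow (k + 1)))
        (.star (.star a b) (.star a (rightPow k))) :=
      LDEquiv.star (LDExp.ldEquiv .refl) (hM k (by omega)).symm
    have hd : LDEquiv (.star (.star a b) (.star a (rightPow k)))
        (.star a (.star b (rightPow k))) :=
      (LDExp.ldEquiv (.single (.dist a b _))).symm
    have hb : LDEquiv (.star a (.star b (rightPow k))) (.star a (rightPow (k + 1))) :=
      LDEquiv.star (LDExp.ldEquiv .refl) (hN k (by omega))
    exact ((ha.trans hd).trans hb).trans (hM (k + 1) (by omega))

theorem Sqsub.exists_of_step {u t t' : STerm1} (hu : Sqsub u t) (h : LDStep t t') :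
    ∃ u', LDExp u u' ∧ Sqsub u' t' := by
  induction hu generalizing t' with
  | base b =>
    cases h with
    | dist _ b c => exact ⟨u, .refl, .step _ (.base _ _)⟩
    | left _ h => exact ⟨_, .single h, .base _ _⟩
    | right _ h => exact ⟨u, .refl, .base _ _⟩
  | step w hu ih =>
    cases h with
    | dist _ b c => exact ⟨_, .refl, .step _ (.step _ hu)⟩
    | left _ h =>
      obtain ⟨u', h₁, h₂⟩ := ih h
      exact ⟨u', h₁, .step _ h₂⟩
    | right _ h => exact ⟨_, .refl, .step _ hu⟩

theorem Sqsub.exists_of_ldExp {u t t' : STerm1} (hu : Sqsub u t) (h : LDExp t t') :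
    ∃ u', LDExp u u' ∧ Sqsub u' t' := by
  induction h with
  | refl => exact ⟨u, .refl, hu⟩
  | tail _ h ih =>
    obtain ⟨v, huv, hv⟩ := ih
    obtain ⟨w, hvw, hw⟩ := hv.exists_of_step h
    exact ⟨w, huv.trans hvw, hw⟩

theorem Sqsub.trichotomy {s t r : STerm1} (hs : Sqsub s r) (ht : Sqsub t r) :
    s = t ∨ Sqsub s t ∨ Sqsub t s := by
  induction hs with
  | base b =>
    cases ht with
    | base => exact .inl rfl
    | step _ h => exact .inr (.inr h)
  | step b hs ih =>
    cases ht with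
    | base => exact .inr (.inl hs)
    | step _ h => exact ih h

/-- The comparison property: any two one-variable terms have expansions that are equal or
comparable for iterated left division. -/
theorem exists_ldExp_comparison (s t : STerm1) :
    ∃ s' t', LDExp s s' ∧ LDExp t t' ∧ (s' = t' ∨ Sqsub s' t' ∨ Sqsub t' s') := by
  obtain ⟨M, hM⟩ := exists_star_rightPow_ldEquiv s
  obtain ⟨N, hN⟩ := exists_star_rightPow_ldEquiv t
  obtain ⟨r, hs, ht⟩ := (hM (max M N) (le_max_left _ _)).trans
    (hN (max M N) (le_max_right _ _)).symm
  obtain ⟨s', hs', hsr⟩ := (Sqsub.base s _).exists_of_ldExp hs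
  obtain ⟨t', ht', htr⟩ := (Sqsub.base t _).exists_of_ldExp ht
  exact ⟨s', t', hs', ht', hsr.trichotomy htr⟩

/-! ### Normal forms for `{*,∘}`-terms -/

theorem LDStep.aldCong {s t : STerm1} (h : LDStep s t) : ALDCong s.toTerm1 t.toTerm1 := by
  induction h with
  | dist a b c => exact .LD _ _ _
  | left b _ ih => exact .starCong ih (.refl _)
  | right a _ ih => exact .starCong (.refl _) ih

theorem LDExp.aldCong {s t : STerm1} (h : LDExp s t) : ALDCong s.toTerm1 t.toTerm1 := by
  induction h with
  | refl => exact .refl _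
  | tail _ h ih => exact ih.trans h.aldCong

theorem Subst.exists_star_toTerm1 {u : CTerm} {ss : List STerm1} {t : Term1}
    (h : Subst u ss t) (s : STerm1) :
    ∃ r : STerm1, ALDCong (.star t s.toTerm1) r.toTerm1 := by
  induction h generalizing s with
  | var a => exact ⟨.star a s, .refl _⟩
  | circ _ _ ihu ihv =>
    obtain ⟨r, hr⟩ := ihv s
    obtain ⟨q, hq⟩ := ihu r
    exact ⟨q, ((ALDCong.ALD1 _ _ _).trans (.starCong (.refl _) hr)).trans hq⟩

theorem Subst.exists_star {u v : CTerm} {ss ts : List STerm1} {t t' : Term1}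
    (h : Subst u ss t) (h' : Subst v ts t') :
    ∃ (w : CTerm) (rs : List STerm1) (r : Term1), Subst w rs r ∧ ALDCong (.star t t') r := by
  induction h' with
  | var s =>
    obtain ⟨r, hr⟩ := h.exists_star_toTerm1 s
    exact ⟨.var, [r], _, .var r, hr⟩
  | circ _ _ ih₁ ih₂ =>
    obtain ⟨w₁, rs₁, r₁, h₁, e₁⟩ := ih₁
    obtain ⟨w₂, rs₂, r₂, h₂, e₂⟩ := ih₂
    exact ⟨_, _, _, h₁.circ h₂, (ALDCong.ALD2 _ _ _).trans (.circCong e₁ e₂)⟩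

theorem Term1.exists_subst_aldCong (t : Term1) :
    ∃ (u : CTerm) (ss : List STerm1) (r : Term1), Subst u ss r ∧ ALDCong t r := by
  induction t with
  | var => exact ⟨.var, [.var], _, .var .var, .refl _⟩
  | star a b iha ihb =>
    obtain ⟨u, ss, r, h, e⟩ := iha
    obtain ⟨v, ts, r', h', e'⟩ := ihb
    obtain ⟨w, rs, q, hw, ew⟩ := h.exists_star h'
    exact ⟨w, rs, q, hw, (ALDCong.starCong e e').trans ew⟩
  | circ a b iha ihb =>
    obtain ⟨u, ss, r, h, e⟩ := iha
    obtain ⟨v, ts, r', h', e'⟩ := ihb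
    exact ⟨_, _, _, h.circ h', .circCong e e'⟩

theorem CTerm.lt_trichotomy (u v : CTerm) : u = v ∨ CTerm.lt u v ∨ CTerm.lt v u := by
  induction u generalizing v with
  | var =>
    cases v with
    | var => exact .inl rfl
    | circ => exact .inr (.inl (.var _ _))
  | circ u₁ u₂ ih₁ ih₂ =>
    cases v with
    | var => exact .inr (.inr (.var _ _))
    | circ v₁ v₂ =>
      rcases ih₁ v₁ with rfl | h | h
      · rcases ih₂ v₂ with rfl | h | h
        · exact .inl rfl
        · exact .inr (.inl (.right _ h))
        · exact .inr (.inr (.right _ h))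
      · exact .inr (.inl (.left _ _ h))
      · exact .inr (.inr (.left _ _ h))

theorem Subst.length_eq {u : CTerm} {ss ts : List STerm1} {t t' : Term1}
    (h : Subst u ss t) (h' : Subst u ts t') : ss.length = ts.length := by
  induction h generalizing ts t' with
  | var => cases h'; rfl
  | circ _ _ ih₁ ih₂ =>
    cases h' with
    | circ h₁ h₂ => simp only [List.length_append, ih₁ h₁, ih₂ h₂]

theorem VSqsub.append_right {ss ts : List STerm1} (h : VSqsub ss ts) {ss' ts' : List STerm1}
    (hl : ss'.length = ts'.length) : VSqsub (ss ++ ss') (ts ++ ts') := by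
  induction h with
  | head h hl' =>
    exact .head h (List.length_append.trans ((congrArg₂ _ hl' hl).trans List.length_append.symm))
  | cons s _ ih => exact .cons s ih

theorem VSqsub.append_left (rs : List STerm1) {ss ts : List STerm1} (h : VSqsub ss ts) :
    VSqsub (rs ++ ss) (rs ++ ts) := by
  induction rs with
  | nil => exact h
  | cons s _ ih => exact .cons s ih

/-- Two substitution instances of the same `∘`-term are equivalent, or equivalent to instances
at comparable sequences. -/
theorem Subst.comparison {u : CTerm} {ss ts : List STerm1} {t t' : Term1}
    (h : Subst u ss t) (h' : Subst u ts t') :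
    ALDCong t t' ∨ ∃ (ss' ts' : List STerm1) (r r' : Term1),
      Subst u ss' r ∧ Subst u ts' r' ∧ ALDCong t r ∧ ALDCong t' r' ∧
        (VSqsub ss' ts' ∨ VSqsub ts' ss') := by
  induction h generalizing ts t' with
  | var s =>
    cases h' with
    | var s₂ =>
      obtain ⟨a, b, ha, hb, rfl | h | h⟩ := exists_ldExp_comparison s s₂
      · exact .inl (ha.aldCong.trans hb.aldCong.symm)
      · exact .inr ⟨[a], [b], _, _, .var a, .var b, ha.aldCong, hb.aldCong, .inl (.head h rfl)⟩
      · exact .inr ⟨[a], [b], _, _, .var a, .var b, ha.aldCong, hb.aldCong, .inr (.head h rfl)⟩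
  | circ k₁ k₂ ih₁ ih₂ =>
    cases h' with
    | circ h₁ h₂ =>
      rcases ih₁ h₁ with e | ⟨as, bs, r, r', ha, hb, ea, eb, h⟩
      · rcases ih₂ h₂ with e' | ⟨as, bs, r, r', ha, hb, ea, eb, h⟩
        · exact .inl (.circCong e e')
        · exact .inr ⟨_, _, _, _, k₁.circ ha, k₁.circ hb, .circCong (.refl _) ea,
            .circCong e.symm eb, h.imp (.append_left _) (.append_left _)⟩
      · have hl := k₂.length_eq h₂
        exact .inr ⟨_, _, _, _, ha.circ k₂, hb.circ h₂, .circCong ea (.refl _),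
          .circCong eb (.refl _), h.imp (·.append_right hl) (·.append_right hl.symm)⟩

theorem ALDCong.evalT_eq {S : Type*} {star circ : S → S → S}
    (hLD : ∀ x y z : S, star x (star y z) = star (star x y) (star x z))
    (hALD1 : ∀ x y z : S, star (circ x y) z = star x (star y z))
    (hALD2 : ∀ x y z : S, star x (circ y z) = circ (star x y) (star x z))
    (γ : S) {t t' : Term1} (h : ALDCong t t') :
    evalT star circ γ t = evalT star circ γ t' := by
  induction h with
  | LD => exact hLD _ _ _
  | ALD1 => exact hALD1 _ _ _
  | ALD2 => exact hALD2 _ _ _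
  | refl => rfl
  | symm _ ih => exact ih.symm
  | trans _ _ ih₁ ih₂ => exact ih₁.trans ih₂
  | starCong _ _ ih₁ ih₂ => exact congrArg₂ star ih₁ ih₂
  | circCong _ _ ih₁ ih₂ => exact congrArg₂ circ ih₁ ih₂

/-- freeness criterion. If an ALD-system `S` and `γ ∈ S` satisfy no
equality `u[⃗s](γ) = v[⃗t](γ)` with `u < v`, or `u = v` and `⃗s ⃗⊏ ⃗t`, then the
sub-ALD-system of `S` generated by `γ` is free based on `{γ}`. -/
theorem free_criterion {S : Type*} (star circ : S → S → S)
    (hLD : ∀ x y z : S, star x (star y z) = star (star x y) (star x z))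
    (hALD1 : ∀ x y z : S, star (circ x y) z = star x (star y z))
    (hALD2 : ∀ x y z : S, star x (circ y z) = circ (star x y) (star x z))
    (γ : S)
    (hcrit : ¬ ∃ (u v : CTerm) (ss ts : List STerm1) (t t' : Term1),
        Subst u ss t ∧ Subst v ts t' ∧
        (CTerm.lt u v ∨ (u = v ∧ VSqsub ss ts)) ∧
        evalT star circ γ t = evalT star circ γ t') :
    ∀ t t' : Term1, evalT star circ γ t = evalT star circ γ t' → ALDCong t t' := by
  intro t t' heq
  have sound := fun {a b : Term1} (h : ALDCong a b) => h.evalT_eq hLD hALD1 hALD2 γ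
  obtain ⟨u, ss, r, hr, e⟩ := t.exists_subst_aldCong
  obtain ⟨v, ts, r', hr', e'⟩ := t'.exists_subst_aldCong
  have hrr : evalT star circ γ r = evalT star circ γ r' :=
    ((sound e).symm.trans heq).trans (sound e')
  rcases CTerm.lt_trichotomy u v with rfl | h | h
  · rcases hr.comparison hr' with h | ⟨as, bs, q, q', ha, hb, ea, eb, h⟩
    · exact (e.trans h).trans e'.symm
    · have hqq : evalT star circ γ q = evalT star circ γ q' :=
        ((sound ea).symm.trans hrr).trans (sound eb)
      rcases h with h | h
      · exact absurd ⟨u, u, as, bs, q, q', ha, hb, .inr ⟨rfl, h⟩, hqq⟩ hcrit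
      · exact absurd ⟨u, u, bs, as, q', q, hb, ha, .inr ⟨rfl, h⟩, hqq.symm⟩ hcrit
  · exact absurd ⟨u, v, ss, ts, r, r', hr, hr', .inl h, hrr⟩ hcrit
  · exact absurd ⟨v, u, ts, ss, r', r, hr', hr, .inl h, hrr.symm⟩ hcrit
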